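/- For every even integer k ≥ 2 and all r, s ∈ ℕ, the set { d_k^full(N) − ((k−1)/12)·ψ^full(N) : N ∈ ℕ, ω(N) < r, H(N) ≤ s } has cardinality at most η·√s·r·(r+1)², where ω(N) is the number of distinct prime divisors of N, H(N) is the largest squarefull divisor of N, and η = ζ(3/2)/ζ(3) with ζ the Riemann zeta function. -/

import Mathlib

noncomputable section

/-- Value at `N` of the multiplicative function determined by local values `f p e`
on prime powers `p^e` (`e ≥ 1`). -/
def mval (f : ℕ → ℕ → ℝ) (N : ℕ) : ℝ := ∏ p ∈ N.primeFactors, f p (N.factorization p)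

def psiFull : ℕ → ℝ := mval fun p e => (p:ℝ)^e + (p:ℝ)^(e-1)

def nuInfFull : ℕ → ℝ := mval fun p e =>
  if Odd e then 2*(p:ℝ)^((e-1)/2) else (p:ℝ)^(e/2) + (p:ℝ)^(e/2-1)

def nu2Full : ℕ → ℝ := mval fun p e =>
  if p^e = 2 then 1 else if p % 4 = 1 then 2 else 0

def nu3Full : ℕ → ℝ := mval fun p e =>
  if p^e = 3 then 1 else if p % 3 = 1 then 2 else 0

def psiNew : ℕ → ℝ := mval fun p e =>
  if e = 1 then (p:ℝ)-1
  else if e = 2 then (p:ℝ)^2-(p:ℝ)-1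
  else (p:ℝ)^(e-3)*((p:ℝ)-1)^2*((p:ℝ)+1)

def nuInfNew : ℕ → ℝ := mval fun p e =>
  if e = 2 then (p:ℝ)-2
  else if Even e ∧ 2 < e then (p:ℝ)^(e/2-2)*((p:ℝ)-1)^2
  else 0

def nu2New : ℕ → ℝ := mval fun p e =>
  if p % 4 = 3 ∧ e = 1 then -2
  else if (p % 4 = 3 ∧ e = 2) ∨ p^e = 8 then 1
  else if (p % 4 = 1 ∧ e = 2) ∨ p^e = 2 ∨ p^e = 4 then -1
  else 0

def nu3New : ℕ → ℝ := mval fun p e =>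
  if p % 3 = 2 ∧ e = 1 then -2
  else if (p % 3 = 2 ∧ e = 2) ∨ p^e = 27 then 1
  else if (p % 3 = 1 ∧ e = 2) ∨ p^e = 3 ∨ p^e = 9 then -1
  else 0

def psiMin : ℕ → ℝ := mval fun p e =>
  ((p:ℝ)-1)/((Nat.gcd (Nat.gcd 2 (p-1)) e : ℕ) : ℝ)
    * (if e = 1 then 1 else if e = 2 then (p:ℝ)-1 else (p:ℝ)^(e-3)*((p:ℝ)^2-1))

def nuInfMin : ℕ → ℝ := mval fun p e =>
  if p = 2 ∧ Even e ∧ 2 < e then (2:ℝ)^(e/2-2) else 0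

def nu2Min : ℕ → ℝ := mval fun p e =>
  if p % 4 = 3 then -2*((ArithmeticFunction.moebius (p^(e-1)) : ℤ) : ℝ)
  else if p^e = 2 ∨ p^e = 4 then -1
  else if p^e = 8 then 1
  else 0

def nu3Min : ℕ → ℝ := mval fun p e =>
  if p % 3 = 2 ∧ p^e ≠ 4 then -2*((ArithmeticFunction.moebius (p^(e-1)) : ℤ) : ℝ)
  else if p^e = 3 ∨ p^e = 9 then -1
  else if p^e = 4 ∨ p^e = 27 then 1
  else 0

/-- The Kronecker symbol `(−4|n)`, i.e. the nontrivial character mod 4. -/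
def chi4 (n : ℕ) : ℝ := if n % 4 = 1 then 1 else if n % 4 = 3 then -1 else 0

/-- The Kronecker symbol `(−3|n)`, i.e. the nontrivial character mod 3. -/
def chi3 (n : ℕ) : ℝ := if n % 3 = 1 then 1 else if n % 3 = 2 then -1 else 0

def c2 (k : ℕ) : ℝ := -(1/4) * chi4 (k-1)

def c3 (k : ℕ) : ℝ := -(1/3) * chi3 (k-1)

def delta2 (k : ℕ) : ℝ := if k = 2 then 1 else 0

def dFull (k N : ℕ) : ℝ :=
  ((k:ℝ)-1)/12 * psiFull N - 1/2 * nuInfFull N + c2 k * nu2Full N + c3 k * nu3Full N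
    + delta2 k

def dNew (k N : ℕ) : ℝ :=
  ((k:ℝ)-1)/12 * psiNew N - 1/2 * nuInfNew N + c2 k * nu2New N + c3 k * nu3New N
    + delta2 k * ((ArithmeticFunction.moebius N : ℤ) : ℝ)

def dMin (k N : ℕ) : ℝ :=
  ((k:ℝ)-1)/12 * psiMin N - 1/2 * nuInfMin N + c2 k * nu2Min N + c3 k * nu3Min N
    + delta2 k * ((ArithmeticFunction.moebius N : ℤ) : ℝ)

/-- `ω(N)`: the number of distinct prime divisors of `N`. -/
def omega (N : ℕ) : ℕ := N.primeFactors.card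

/-- A positive integer is squarefull if `p² ∣ N` for every prime `p ∣ N`. -/
def Squarefull (n : ℕ) : Prop := ∀ p : ℕ, p.Prime → p ∣ n → p^2 ∣ n

/-- `H(N)`: the largest squarefull divisor of `N`. -/
def squarefullPart (N : ℕ) : ℕ := sSup {d : ℕ | d ∣ N ∧ Squarefull d}

/-- `η = ζ(3/2)/ζ(3)`. -/
def eta : ℝ := (riemannZeta (3/2) / riemannZeta 3).re

/-- Ford's coefficients `a_n = (n+1)log(n+1) − n log n − 1`. -/
def fordA (n : ℕ) : ℝ := ((n:ℝ)+1)*Real.log ((n:ℝ)+1) - (n:ℝ)*Real.log n - 1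


def loglog (x : ℝ) : ℝ := Real.log (Real.log x)

def logloglog (x : ℝ) : ℝ := Real.log (Real.log (Real.log x))

def loglogloglog (x : ℝ) : ℝ := Real.log (Real.log (Real.log (Real.log x)))

end

lemma zetaR_a (x : ℝ) (hx : 1 < x) :
    riemannZeta (x:ℂ) = ((∑' n : ℕ, 1 / (n:ℝ)^x : ℝ) : ℂ) := by
  rw [zeta_eq_tsum_one_div_nat_cpow (by simpa using hx), Complex.ofReal_tsum]
  congr 1; ext n
  rw [Complex.ofReal_div, Complex.ofReal_cpow (by positivity)]
  simp

lemma zetaR_b (x : ℝ) (hx : 1 < x) :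
    riemannZeta (x:ℂ) = ((∑' n : ℕ, 1 / (((n+1:ℕ):ℝ))^x : ℝ) : ℂ) := by
  rw [zeta_eq_tsum_one_div_nat_add_one_cpow (by simpa using hx), Complex.ofReal_tsum]
  congr 1; ext n
  rw [Complex.ofReal_div, Complex.ofReal_cpow (by positivity)]
  simp

lemma eta_eq : eta = (∑' n : ℕ, 1 / (n:ℝ)^(3/2:ℝ)) / (∑' n : ℕ, 1 / (((n+1:ℕ):ℝ))^(3:ℝ)) := by
  unfold eta
  have h1 := zetaR_a (3/2) (by norm_num)
  have h2 := zetaR_b 3 (by norm_num)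
  push_cast at h1 h2
  rw [h1, h2]
  norm_cast

lemma sq_inj {d b d' b' : ℕ} (hd : d ≠ 0) (hd' : d' ≠ 0) (hb : Squarefree b) (hb' : Squarefree b')
    (h : d^2*b = d'^2*b') : b = b' ∧ d = d' := by
  have hbb : b = b' := by
    apply Nat.eq_of_factorization_eq hb.ne_zero hb'.ne_zero
    intro p
    have := congrArg (fun n => n.factorization p) h
    simp only [Nat.factorization_mul (pow_ne_zero 2 hd) hb.ne_zero,
      Nat.factorization_mul (pow_ne_zero 2 hd') hb'.ne_zero, Nat.factorization_pow,
      Finsupp.add_apply, Finsupp.smul_apply, smul_eq_mul] at this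
    have := hb.natFactorization_le_one p
    have := hb'.natFactorization_le_one p
    omega
  refine ⟨hbb, ?_⟩
  subst hbb
  have := Nat.eq_of_mul_eq_mul_right (Nat.pos_of_ne_zero hb.ne_zero) h
  exact Nat.pow_left_injective (by norm_num : (2:ℕ) ≠ 0) this

lemma sum_le_eta (B : Finset ℕ) (hB : ∀ b ∈ B, Squarefree b) :
    ∑ b ∈ B, 1 / (b:ℝ)^(3/2:ℝ) ≤ eta := by
  rw [eta_eq]
  have s3 : Summable (fun n : ℕ => 1 / (((n+1:ℕ):ℝ))^(3:ℝ)) :=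
    (summable_nat_add_iff 1).2 (Real.summable_one_div_nat_rpow.2 (by norm_num : (1:ℝ) < 3))
  have s2 : Summable (fun n : ℕ => 1 / (n:ℝ)^(3/2:ℝ)) :=
    Real.summable_one_div_nat_rpow.2 (by norm_num)
  have hpos : 0 < ∑' n : ℕ, 1 / (((n+1:ℕ):ℝ))^(3:ℝ) :=
    s3.tsum_pos (fun n => by positivity) 0 (by positivity)
  rw [le_div_iff₀ hpos]
  let i : B × ℕ → ℕ := fun x => (x.2+1)^2 * x.1.1
  have hi : Function.Injective i := by
    rintro ⟨⟨b, hb⟩, d⟩ ⟨⟨b', hb'⟩, d'⟩ h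
    obtain ⟨h1, h2⟩ := sq_inj (Nat.succ_ne_zero d) (Nat.succ_ne_zero d') (hB b hb) (hB b' hb') h
    subst h1
    simp at h2
    simp [h2]
  have key := tsum_comp_le_tsum_of_inj s2 (fun n => by positivity) hi
  have hs : Summable ((fun n : ℕ => 1 / (n:ℝ)^(3/2:ℝ)) ∘ i) := s2.comp_injective hi
  refine le_trans (le_of_eq ?_) key
  rw [hs.tsum_prod, tsum_fintype (L := SummationFilter.unconditional B), ← Finset.sum_coe_sort B, Finset.sum_mul]
  apply Finset.sum_congr rfl
  intro b _
  rw [← tsum_mul_left]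
  congr 1; ext d
  simp only [Function.comp, i]
  rw [Nat.cast_mul, Real.mul_rpow (by positivity) (by positivity), Nat.cast_pow,
    ← Real.rpow_natCast, ← Real.rpow_mul (by positivity)]
  norm_num

lemma sqfull_decomp {n : ℕ} (hn : n ≠ 0) (h : Squarefull n) :
    ∃ b a, Squarefree b ∧ n = b^3 * a^2 := by
  obtain ⟨b, m, hb0, hm0, hbm, hb⟩ := Nat.sq_mul_squarefree_of_pos (Nat.pos_of_ne_zero hn)
  have : b ∣ m := by
    rw [← Nat.factorization_le_iff_dvd hb0.ne' hm0.ne']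
    intro p
    have h1 := hb.natFactorization_le_one p
    by_contra hlt
    push Not at hlt
    have hp : p ∈ b.primeFactors := by
      rw [← Nat.support_factorization, Finsupp.mem_support_iff]; omega
    have hpp := Nat.prime_of_mem_primeFactors hp
    have hd : p ∣ n := (Nat.dvd_of_mem_primeFactors hp).trans ⟨m^2, by rw [← hbm]; ring⟩
    have h2 := (hpp.pow_dvd_iff_le_factorization hn).1 (h p hpp hd)
    rw [← hbm, Nat.factorization_mul (by positivity) hb0.ne', Nat.factorization_pow] at h2
    simp only [Finsupp.add_apply, Finsupp.smul_apply, smul_eq_mul] at h2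
    omega
  obtain ⟨a, rfl⟩ := this
  exact ⟨b, a, hb, by rw [← hbm]; ring⟩

open Classical in
lemma card_sqfull (s : ℕ) :
    (((Finset.Icc 1 s).filter Squarefull).card : ℝ) ≤ eta * Real.sqrt s := by
  let B := (Finset.Icc 1 s).filter (fun b : ℕ => Squarefree b)
  let T : Finset (Σ _ : ℕ, ℕ) := B.sigma (fun b => Finset.Icc 1 ⌊Real.sqrt s * (1 / (b:ℝ)^(3/2:ℝ))⌋₊)
  have hsub : (Finset.Icc 1 s).filter Squarefull ⊆ T.image (fun x => x.1^3 * x.2^2) := by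
    intro n hn
    simp only [Finset.mem_filter, Finset.mem_Icc] at hn
    obtain ⟨⟨h1, h2⟩, h3⟩ := hn
    obtain ⟨b, a, hb, rfl⟩ := sqfull_decomp (by omega) h3
    have hb0 : 0 < b := Nat.pos_of_ne_zero hb.ne_zero
    have ha0 : 0 < a := Nat.pos_of_ne_zero (by rintro rfl; simp at h1)
    refine Finset.mem_image.2 ⟨⟨b, a⟩, ?_, rfl⟩
    simp only [T, B, Finset.mem_sigma, Finset.mem_filter, Finset.mem_Icc]
    refine ⟨⟨⟨hb0, ?_⟩, hb⟩, ha0, ?_⟩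
    · calc b ≤ b^3 := Nat.le_self_pow (by norm_num) b
        _ ≤ b^3 * a^2 := Nat.le_mul_of_pos_right _ (by positivity)
        _ ≤ s := h2
    · apply Nat.le_floor
      have hb' : (0:ℝ) < b := by exact_mod_cast hb0
      rw [mul_one_div, le_div_iff₀ (by positivity)]
      apply Real.le_sqrt_of_sq_le
      have : ((b:ℝ)^(3/2:ℝ))^2 = (b:ℝ)^3 := by
        rw [← Real.rpow_natCast, ← Real.rpow_mul hb'.le, ← Real.rpow_natCast]; norm_num
      rw [mul_pow, this, mul_comm]
      exact_mod_cast h2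
  have hc : ((Finset.Icc 1 s).filter Squarefull).card ≤ T.card :=
    (Finset.card_le_card hsub).trans Finset.card_image_le
  calc (((Finset.Icc 1 s).filter Squarefull).card : ℝ) ≤ T.card := by exact_mod_cast hc
    _ = ∑ b ∈ B, (⌊Real.sqrt s * (1 / (b:ℝ)^(3/2:ℝ))⌋₊ : ℝ) := by
        simp [T, Finset.card_sigma]
    _ ≤ ∑ b ∈ B, Real.sqrt s * (1 / (b:ℝ)^(3/2:ℝ)) :=
        Finset.sum_le_sum fun b _ => Nat.floor_le (by positivity)
    _ = (∑ b ∈ B, 1 / (b:ℝ)^(3/2:ℝ)) * Real.sqrt s := by rw [← Finset.mul_sum, mul_comm]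
    _ ≤ eta * Real.sqrt s := by
        gcongr
        exact sum_le_eta B fun b hb => (Finset.mem_filter.1 hb).2

lemma prod_012 (S : Finset ℕ) (g : ℕ → ℝ) (hg : ∀ p ∈ S, g p = 0 ∨ g p = 1 ∨ g p = 2) :
    (∏ p ∈ S, g p) = 0 ∨ ∃ a ≤ S.card, (∏ p ∈ S, g p) = 2^a := by
  classical
  induction S using Finset.induction_on with
  | empty => right; exact ⟨0, by simp, by simp⟩
  | insert q S hq ih =>
    rw [Finset.prod_insert hq, Finset.card_insert_of_notMem hq]
    rcases ih (fun p hp => hg p (Finset.mem_insert_of_mem hp)) with h | ⟨a, ha, h⟩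
    · left; simp [h]
    · rcases hg q (Finset.mem_insert_self _ _) with h' | h' | h'
      · left; simp [h']
      · right; exact ⟨a, by omega, by simp [h, h']⟩
      · right; exact ⟨a+1, by omega, by rw [h, h']; ring⟩

noncomputable def pows (r : ℕ) : Finset ℝ := insert 0 ((Finset.range r).image fun a => (2:ℝ)^a)

lemma pows_card (r : ℕ) : (pows r).card ≤ r + 1 := by
  unfold pows
  refine (Finset.card_insert_le _ _).trans ?_
  have := Finset.card_image_le (s := Finset.range r) (f := fun a => (2:ℝ)^a)
  simp only [Finset.card_range] at this
  omega

lemma mval_mem_pows (f : ℕ → ℕ → ℝ) (hf : ∀ p e, f p e = 0 ∨ f p e = 1 ∨ f p e = 2)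
    {N r : ℕ} (h : omega N < r) : mval f N ∈ pows r := by
  unfold mval pows
  rcases prod_012 N.primeFactors (fun p => f p (N.factorization p)) (fun p _ => hf _ _) with
    h' | ⟨a, ha, h'⟩
  · rw [h']; simp
  · rw [h']
    apply Finset.mem_insert_of_mem
    refine Finset.mem_image.2 ⟨a, ?_, rfl⟩
    rw [Finset.mem_range]
    exact lt_of_le_of_lt ha h

lemma nuInf_decomp {N r s : ℕ} (hN : 1 ≤ N) (hr : omega N < r) (hs : squarefullPart N ≤ s) :
    ∃ h, 1 ≤ h ∧ h ≤ s ∧ Squarefull h ∧ ∃ j < r, nuInfFull N = 2^j * nuInfFull h := by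
  have hN0 : N ≠ 0 := by omega
  let F : ℕ →₀ ℕ := N.factorization.filter (fun p => 2 ≤ N.factorization p)
  have hFle : F ≤ N.factorization := by
    intro p
    by_cases hp : 2 ≤ N.factorization p
    · simp [F, Finsupp.filter_apply, hp]
    · simp [F, Finsupp.filter_apply, hp]
  have hFs : F.support = N.primeFactors.filter (fun p => 2 ≤ N.factorization p) := by
    simp [F, Finsupp.support_filter]
  have hFp : ∀ p ∈ F.support, p.Prime := by
    intro p hp
    rw [hFs] at hp
    exact Nat.prime_of_mem_primeFactors (Finset.mem_filter.1 hp).1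
  let h := F.prod (· ^ ·)
  have hfac : h.factorization = F := Nat.prod_pow_factorization_eq_self hFp
  have hprim : h.primeFactors = N.primeFactors.filter (fun p => 2 ≤ N.factorization p) := by
    rw [← Nat.support_factorization, hfac, hFs]
  have h0 : h ≠ 0 := by
    simp only [h, Finsupp.prod]
    exact Finset.prod_ne_zero_iff.2 fun p hp => pow_ne_zero _ (hFp p hp).ne_zero
  have hdvd : h ∣ N := by
    rw [← Nat.factorization_le_iff_dvd h0 hN0, hfac]; exact hFle
  have hF2 : ∀ p ∈ N.primeFactors.filter (fun p => 2 ≤ N.factorization p),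
      F p = N.factorization p := by
    intro p hp
    simp [F, Finsupp.filter_apply, (Finset.mem_filter.1 hp).2]
  have hsf : Squarefull h := by
    intro p hp hd
    have hm : p ∈ h.primeFactors := Nat.mem_primeFactors.2 ⟨hp, hd, h0⟩
    rw [hprim] at hm
    rw [hp.pow_dvd_iff_le_factorization h0, hfac, hF2 p hm]
    exact (Finset.mem_filter.1 hm).2
  have hle : h ≤ squarefullPart N := by
    apply le_csSup
    · exact ⟨N, fun d hd => Nat.le_of_dvd (by omega) hd.1⟩
    · exact ⟨hdvd, hsf⟩
  refine ⟨h, Nat.pos_of_ne_zero h0, hle.trans hs, hsf,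
    (N.primeFactors.filter (fun p => ¬ 2 ≤ N.factorization p)).card, ?_, ?_⟩
  · exact lt_of_le_of_lt (Finset.card_filter_le _ _) hr
  · unfold nuInfFull mval
    rw [hprim, ← Finset.prod_filter_mul_prod_filter_not N.primeFactors
      (fun p => 2 ≤ N.factorization p), mul_comm]
    congr 1
    · rw [← Finset.prod_const]
      apply Finset.prod_congr rfl
      intro p hp
      obtain ⟨hp1, hp2⟩ := Finset.mem_filter.1 hp
      have : N.factorization p ≠ 0 := by
        rw [← Nat.support_factorization, Finsupp.mem_support_iff] at hp1; exact hp1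
      have : N.factorization p = 1 := by omega
      simp [this]
    · apply Finset.prod_congr rfl
      intro p hp
      rw [hfac, hF2 p hp]

theorem values_full (k : ℕ) (hk2 : 2 ≤ k) (hk : Even k) (r s : ℕ) :
    (Set.ncard {y : ℝ | ∃ N : ℕ, 1 ≤ N ∧ omega N < r ∧ squarefullPart N ≤ s ∧
        y = dFull k N - ((k:ℝ)-1)/12 * psiFull N} : ℝ)
      ≤ eta * Real.sqrt s * r * ((r:ℝ)+1)^2 := by
  classical
  let H := (Finset.Icc 1 s).filter Squarefull
  let P := (H ×ˢ Finset.range r) ×ˢ (pows r ×ˢ pows r)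
  let g : (ℕ × ℕ) × (ℝ × ℝ) → ℝ := fun x =>
    -(1/2) * (2^x.1.2 * nuInfFull x.1.1) + c2 k * x.2.1 + c3 k * x.2.2 + delta2 k
  have hsub : {y : ℝ | ∃ N : ℕ, 1 ≤ N ∧ omega N < r ∧ squarefullPart N ≤ s ∧
        y = dFull k N - ((k:ℝ)-1)/12 * psiFull N} ⊆ ((P.image g : Finset ℝ) : Set ℝ) := by
    rintro y ⟨N, hN, hr, hs, rfl⟩
    obtain ⟨h, h1, h2, h3, j, hj, e⟩ := nuInf_decomp hN hr hs
    have m2 : nu2Full N ∈ pows r := mval_mem_pows _ (fun p e => by split_ifs <;> simp) hr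
    have m3 : nu3Full N ∈ pows r := mval_mem_pows _ (fun p e => by split_ifs <;> simp) hr
    refine Finset.mem_coe.2 (Finset.mem_image.2 ⟨((h, j), (nu2Full N, nu3Full N)), ?_, ?_⟩)
    · simp only [P, H, Finset.mem_product, Finset.mem_filter, Finset.mem_Icc, Finset.mem_range]
      exact ⟨⟨⟨⟨h1, h2⟩, h3⟩, hj⟩, m2, m3⟩
    · simp only [g, dFull]
      rw [← e]; ring
  have hc := Set.ncard_le_ncard hsub (Finset.finite_toSet _)
  rw [Set.ncard_coe_finset] at hc
  have hc2 : (P.image g).card ≤ H.card * r * ((r+1) * (r+1)) := by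
    refine Finset.card_image_le.trans ?_
    simp only [P, Finset.card_product, Finset.card_range]
    gcongr <;> exact pows_card r
  have hH : (H.card : ℝ) ≤ eta * Real.sqrt s := by
    convert card_sqfull s
  calc _ ≤ ((H.card * r * ((r+1) * (r+1)) : ℕ) : ℝ) := by exact_mod_cast hc.trans hc2
    _ = (H.card : ℝ) * r * ((r:ℝ)+1)^2 := by push_cast; ring
    _ ≤ _ := by gcongr
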